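/- Substitution lemma for the complexity semantics: for any complexity term t, environment ξ, variable x, cost a, potential b, and fresh variable y, ⟦t⟧ξ[x↦(a,b)] = ⟦t[x↦(a,y)]⟧ξ[y↦b], where t[x↦(a,y)] is the result of substituting the pair expression (a,y) for x in t. -/

import Mathlib

/-! Formalization of the substitution lemma (Lemma 3) of "A static cost
analysis for a higher-order language" (Danner–Paykin–Royer). -/

/-! ### Complexity language: syntax, variables, substitution -/

/-- Complexity-language expressions: variables, numerals, addition, binary max,
pairs, cost/potential projections, abstraction `λ⋆x.r`, application `r ⋆ s`,
`pcase`, and `pfold`. -/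
inductive CExp where
  | var (x : String)
  | lit (n : ℕ)
  | add (r s : CExp)
  | cmax (r s : CExp)
  | pair (r s : CExp)
  | projc (r : CExp)
  | projp (r : CExp)
  | lam (x : String) (r : CExp)
  | app (r s : CExp)
  | pcase (r s : CExp) (p ps : String) (t : CExp)
  | pfold (r s : CExp) (p ps w : String) (t : CExp)

/-- Free variables of a complexity expression. -/
def CExp.fv : CExp → List String
  | .var x => [x]
  | .lit _ => []
  | .add r s => r.fv ++ s.fv
  | .cmax r s => r.fv ++ s.fv
  | .pair r s => r.fv ++ s.fv
  | .projc r => r.fv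
  | .projp r => r.fv
  | .lam x r => r.fv.removeAll [x]
  | .app r s => r.fv ++ s.fv
  | .pcase r s p ps t => r.fv ++ s.fv ++ t.fv.removeAll [p, ps]
  | .pfold r s p ps w t => r.fv ++ s.fv ++ t.fv.removeAll [p, ps, w]

/-- All variables (free and bound) of a complexity expression. -/
def CExp.vars : CExp → List String
  | .var x => [x]
  | .lit _ => []
  | .add r s => r.vars ++ s.vars
  | .cmax r s => r.vars ++ s.vars
  | .pair r s => r.vars ++ s.vars
  | .projc r => r.vars
  | .projp r => r.vars
  | .lam x r => x :: r.vars
  | .app r s => r.vars ++ s.vars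
  | .pcase r s p ps t => p :: ps :: (r.vars ++ s.vars ++ t.vars)
  | .pfold r s p ps w t => p :: ps :: w :: (r.vars ++ s.vars ++ t.vars)

/-- Substitution `e[x ↦ (a, y)]` of the pair expression `(a, y)` (a numeral
paired with a variable) for the variable `x` in `e`. -/
def CExp.substPV : CExp → String → ℕ → String → CExp
  | .var z, x, a, y => if z = x then .pair (.lit a) (.var y) else .var z
  | .lit n, _, _, _ => .lit n
  | .add r s, x, a, y => .add (r.substPV x a y) (s.substPV x a y)
  | .cmax r s, x, a, y => .cmax (r.substPV x a y) (s.substPV x a y)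
  | .pair r s, x, a, y => .pair (r.substPV x a y) (s.substPV x a y)
  | .projc r, x, a, y => .projc (r.substPV x a y)
  | .projp r, x, a, y => .projp (r.substPV x a y)
  | .lam z r, x, a, y => .lam z (if z = x then r else r.substPV x a y)
  | .app r s, x, a, y => .app (r.substPV x a y) (s.substPV x a y)
  | .pcase r s p ps t, x, a, y =>
      .pcase (r.substPV x a y) (s.substPV x a y) p ps
        (if p = x ∨ ps = x then t else t.substPV x a y)
  | .pfold r s p ps w t, x, a, y =>
      .pfold (r.substPV x a y) (s.substPV x a y) p ps w
        (if p = x ∨ ps = x ∨ w = x then t else t.substPV x a y)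
/-! ### Complexity language: full complexity types, denotations, semantics -/

/-- Full complexity types: simple types with products over ℕ.
Complexity types are those of the form `ℕ × γ` with `γ` a potential type;
potential types are `ℕ` and `γ → τ` with `γ` potential and `τ` complexity. -/
inductive FTy where
  | nat : FTy
  | prod : FTy → FTy → FTy
  | arrow : FTy → FTy → FTy
deriving DecidableEq

/-- Standard denotation of full complexity types (ℕ is the natural numbers). -/
def FTy.den : FTy → Type
  | .nat => ℕ
  | .prod a b => a.den × b.den
  | .arrow a b => a.den → b.den

/-- The (componentwise / pointwise) maximum on the denotation of each type. -/
def FTy.max : (τ : FTy) → τ.den → τ.den → τ.den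
  | .nat, a, b => Nat.max a b
  | .prod τ₁ τ₂, a, b =>
      (FTy.max τ₁ (Prod.fst a) (Prod.fst b), FTy.max τ₂ (Prod.snd a) (Prod.snd b))
  | .arrow _ τ₂, f, g => fun z => FTy.max τ₂ (f z) (g z)

/-- Semantic values of the complexity language: an element of the denotation of
some full complexity type. -/
def CVal : Type := (τ : FTy) × τ.den

/-- Complexity-language (semantic) environments. -/
def CEnv : Type := String → CVal

/-- Environment update `ξ[x ↦ v]`. -/
def CEnv.update (ξ : CEnv) (x : String) (v : CVal) : CEnv :=
  fun y => if y = x then v else ξ y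

/-- The denotational semantics of complexity terms, presented as a big-step
relation: `CSem e ξ ⟨τ, d⟩` means `⟦e⟧ξ = d` (at type `τ`).  `dally(n,(c,p)) =
(n+c,p)` is inlined in the `app` rule, and in the `pfold` rule on a successor
`q+1` a fresh variable `y` is bound to `q` for the recursive value `rec`. -/
inductive CSem : CExp → CEnv → CVal → Prop where
  | var {x ξ} : CSem (.var x) ξ (ξ x)
  | lit {n ξ} : CSem (.lit n) ξ ⟨.nat, n⟩
  | add {r s ξ} {m n : ℕ} : CSem r ξ ⟨.nat, m⟩ → CSem s ξ ⟨.nat, n⟩ →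
      CSem (.add r s) ξ ⟨.nat, m + n⟩
  | cmax {r s ξ} {τ : FTy} {a b : τ.den} : CSem r ξ ⟨τ, a⟩ → CSem s ξ ⟨τ, b⟩ →
      CSem (.cmax r s) ξ ⟨τ, τ.max a b⟩
  | pair {r s ξ} {τ₁ τ₂ : FTy} {a : τ₁.den} {b : τ₂.den} :
      CSem r ξ ⟨τ₁, a⟩ → CSem s ξ ⟨τ₂, b⟩ →
      CSem (.pair r s) ξ ⟨.prod τ₁ τ₂, (a, b)⟩
  | projc {r ξ} {τ₁ τ₂ : FTy} {v : (FTy.prod τ₁ τ₂).den} :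
      CSem r ξ ⟨.prod τ₁ τ₂, v⟩ → CSem (.projc r) ξ ⟨τ₁, Prod.fst v⟩
  | projp {r ξ} {τ₁ τ₂ : FTy} {v : (FTy.prod τ₁ τ₂).den} :
      CSem r ξ ⟨.prod τ₁ τ₂, v⟩ → CSem (.projp r) ξ ⟨τ₂, Prod.snd v⟩
  | lam {x r ξ} {γ η : FTy} {f : γ.den → (FTy.prod FTy.nat η).den} :
      (∀ p : γ.den, CSem r (ξ.update x ⟨.prod .nat γ, ((1 : ℕ), p)⟩) ⟨.prod .nat η, f p⟩) →
      CSem (.lam x r) ξ ⟨.prod .nat (.arrow γ (.prod .nat η)), ((1 : ℕ), f)⟩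
  | app {r s ξ} {γ η : FTy} {c₁ c₂ : ℕ} {f : γ.den → (FTy.prod FTy.nat η).den} {p : γ.den} :
      CSem r ξ ⟨.prod .nat (.arrow γ (.prod .nat η)), (c₁, f)⟩ →
      CSem s ξ ⟨.prod .nat γ, (c₂, p)⟩ →
      CSem (.app r s) ξ ⟨.prod .nat η, (1 + c₁ + c₂ + (Prod.fst (f p) : ℕ), Prod.snd (f p))⟩
  | pcaseZero {r s p ps t ξ v} : CSem r ξ ⟨.nat, (0 : ℕ)⟩ → CSem s ξ v →
      CSem (.pcase r s p ps t) ξ v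
  | pcaseSucc {r s p ps t ξ} {q : ℕ} {τ : FTy} {a b : τ.den} :
      CSem r ξ ⟨.nat, q + 1⟩ → CSem s ξ ⟨τ, a⟩ →
      CSem t ((ξ.update p ⟨.nat, (1 : ℕ)⟩).update ps ⟨.nat, q⟩) ⟨τ, b⟩ →
      CSem (.pcase r s p ps t) ξ ⟨τ, τ.max a b⟩
  | pfoldZero {r s p ps w t ξ v} : CSem r ξ ⟨.nat, (0 : ℕ)⟩ → CSem s ξ v →
      CSem (.pfold r s p ps w t) ξ v
  | pfoldSucc {r s p ps w t ξ} {y : String} {q rc sc tc : ℕ} {γ : FTy} {rp sp tp : γ.den} :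
      y ∉ (CExp.pfold r s p ps w t).fv →
      CSem r ξ ⟨.nat, q + 1⟩ →
      CSem (.pfold (.var y) s p ps w t) (ξ.update y ⟨.nat, q⟩) ⟨.prod .nat γ, (rc, rp)⟩ →
      CSem s ξ ⟨.prod .nat γ, (sc, sp)⟩ →
      CSem t (((ξ.update p ⟨.nat, (1 : ℕ)⟩).update ps ⟨.nat, q⟩).update w
                ⟨.prod .nat γ, ((1 : ℕ), rp)⟩) ⟨.prod .nat γ, (tc, tp)⟩ →
      CSem (.pfold r s p ps w t) ξ ⟨.prod .nat γ, (2 + rc + tc, FTy.max γ sp tp)⟩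

mutual
  /-- Potential types among the full complexity types. -/
  inductive IsPot : FTy → Prop where
    | nat : IsPot .nat
    | arrow {γ τ} : IsPot γ → IsCpx τ → IsPot (.arrow γ τ)

  /-- Complexity types among the full complexity types. -/
  inductive IsCpx : FTy → Prop where
    | mk {γ} : IsPot γ → IsCpx (.prod .nat γ)
end

/-! ### A compositional presentation of the semantics

`CExp.Den` is defined by structural recursion on terms, and agrees with the big-step
relation `CSem`. Denotations depend on the environment only through the free variables. -/

/-- The values of an abstraction whose body has denotation `R`, as a function of its argument. -/
def LamRel (R : CVal → CVal → Prop) (v : CVal) : Prop :=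
  ∃ (γ η : FTy) (f : γ.den → (FTy.prod FTy.nat η).den),
    (∀ p : γ.den, R ⟨.prod .nat γ, ((1 : ℕ), p)⟩ ⟨.prod .nat η, f p⟩) ∧
    v = ⟨.prod .nat (.arrow γ (.prod .nat η)), ((1 : ℕ), f)⟩

/-- The values of a `pcase` on `R` with zero branch `S` and successor branch `T`. -/
def CaseRel (R S : CVal → Prop) (T : CVal → CVal → CVal → Prop) (v : CVal) : Prop :=
  (R ⟨.nat, (0 : ℕ)⟩ ∧ S v) ∨
  ∃ (q : ℕ) (τ : FTy) (a b : τ.den), R ⟨.nat, q + 1⟩ ∧ S ⟨τ, a⟩ ∧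
    T ⟨.nat, (1 : ℕ)⟩ ⟨.nat, q⟩ ⟨τ, b⟩ ∧ v = ⟨τ, τ.max a b⟩

/-- The graph of the `pfold` recursion, for a base case `S` and a step `T`. -/
inductive FoldRel (S : CVal → Prop) (T : CVal → CVal → CVal → CVal → Prop) : ℕ → CVal → Prop where
  | zero {v} : S v → FoldRel S T 0 v
  | succ {q rc sc tc : ℕ} {γ : FTy} {rp sp tp : γ.den} :
      FoldRel S T q ⟨.prod .nat γ, (rc, rp)⟩ →
      S ⟨.prod .nat γ, (sc, sp)⟩ →
      T ⟨.nat, (1 : ℕ)⟩ ⟨.nat, q⟩ ⟨.prod .nat γ, ((1 : ℕ), rp)⟩ ⟨.prod .nat γ, (tc, tp)⟩ →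
      FoldRel S T (q + 1) ⟨.prod .nat γ, (2 + rc + tc, FTy.max γ sp tp)⟩

/-- The denotation of a term in an environment, as a predicate on values. -/
def CExp.Den : CExp → CEnv → CVal → Prop
  | .var x, ξ, v => v = ξ x
  | .lit n, _, v => v = ⟨.nat, n⟩
  | .add r s, ξ, v => ∃ m n : ℕ, r.Den ξ ⟨.nat, m⟩ ∧ s.Den ξ ⟨.nat, n⟩ ∧ v = ⟨.nat, m + n⟩
  | .cmax r s, ξ, v => ∃ (τ : FTy) (a b : τ.den),
      r.Den ξ ⟨τ, a⟩ ∧ s.Den ξ ⟨τ, b⟩ ∧ v = ⟨τ, τ.max a b⟩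
  | .pair r s, ξ, v => ∃ (τ₁ τ₂ : FTy) (a : τ₁.den) (b : τ₂.den),
      r.Den ξ ⟨τ₁, a⟩ ∧ s.Den ξ ⟨τ₂, b⟩ ∧ v = ⟨.prod τ₁ τ₂, (a, b)⟩
  | .projc r, ξ, v => ∃ (τ₁ τ₂ : FTy) (u : (FTy.prod τ₁ τ₂).den),
      r.Den ξ ⟨.prod τ₁ τ₂, u⟩ ∧ v = ⟨τ₁, Prod.fst u⟩
  | .projp r, ξ, v => ∃ (τ₁ τ₂ : FTy) (u : (FTy.prod τ₁ τ₂).den),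
      r.Den ξ ⟨.prod τ₁ τ₂, u⟩ ∧ v = ⟨τ₂, Prod.snd u⟩
  | .lam x r, ξ, v => LamRel (fun u => r.Den (ξ.update x u)) v
  | .app r s, ξ, v => ∃ (γ η : FTy) (c₁ c₂ : ℕ) (f : γ.den → (FTy.prod FTy.nat η).den)
      (p : γ.den), r.Den ξ ⟨.prod .nat (.arrow γ (.prod .nat η)), (c₁, f)⟩ ∧
      s.Den ξ ⟨.prod .nat γ, (c₂, p)⟩ ∧
      v = ⟨.prod .nat η, (1 + c₁ + c₂ + (Prod.fst (f p) : ℕ), Prod.snd (f p))⟩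
  | .pcase r s p ps t, ξ, v =>
      CaseRel (r.Den ξ) (s.Den ξ) (fun u u' => t.Den ((ξ.update p u).update ps u')) v
  | .pfold r s p ps w t, ξ, v => ∃ n : ℕ, r.Den ξ ⟨.nat, n⟩ ∧
      FoldRel (s.Den ξ)
        (fun u u' u'' => t.Den (((ξ.update p u).update ps u').update w u'')) n v

theorem List.mem_removeAll {α : Type*} [BEq α] [LawfulBEq α] {a : α} {l l' : List α} :
    a ∈ l.removeAll l' ↔ a ∈ l ∧ a ∉ l' := by
  simp [List.removeAll]

theorem CEnv.update_self (ξ : CEnv) (x : String) (v : CVal) : ξ.update x v x = v :=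
  if_pos rfl

theorem CEnv.update_of_ne (ξ : CEnv) {x z : String} (h : z ≠ x) (v : CVal) :
    ξ.update x v z = ξ z :=
  if_neg h

theorem CExp.fv_subset_vars (e : CExp) : e.fv ⊆ e.vars := by
  intro z
  induction e <;>
    simp only [CExp.fv, CExp.vars, List.mem_append, List.mem_cons, List.mem_removeAll,
      List.not_mem_nil, or_false] <;>
    tauto

/-- Coincidence: environments agreeing on the free variables give the same denotation. -/
theorem CExp.den_congr (e : CExp) {ξ ξ' : CEnv} (h : ∀ z ∈ e.fv, ξ z = ξ' z) :
    e.Den ξ = e.Den ξ' := by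
  induction e generalizing ξ ξ' with
  | var x => funext v; simp only [CExp.Den, h x (by simp [CExp.fv])]
  | lit n => rfl
  | add r s ihr ihs | cmax r s ihr ihs | pair r s ihr ihs | app r s ihr ihs =>
    simp only [CExp.fv, List.mem_append] at h
    funext v
    simp only [CExp.Den, ihr fun z hz => h z (.inl hz), ihs fun z hz => h z (.inr hz)]
  | projc r ih | projp r ih => funext v; simp only [CExp.Den, ih h]
  | lam x r ih =>
    simp only [CExp.fv, List.mem_removeAll, List.mem_singleton] at h
    have hr (u : CVal) : r.Den (ξ.update x u) = r.Den (ξ'.update x u) :=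
      ih fun z hz => by simp only [CEnv.update]; grind
    funext v
    simp only [CExp.Den, hr]
  | pcase r s p ps t ihr ihs iht =>
    simp only [CExp.fv, List.mem_append, List.mem_removeAll, List.mem_cons,
      List.not_mem_nil, or_false] at h
    have ht (u u' : CVal) :
        t.Den ((ξ.update p u).update ps u') = t.Den ((ξ'.update p u).update ps u') :=
      iht fun z hz => by simp only [CEnv.update]; grind
    funext v
    simp only [CExp.Den, ihr fun z hz => h z (.inl (.inl hz)),
      ihs fun z hz => h z (.inl (.inr hz)), ht]
  | pfold r s p ps w t ihr ihs iht =>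
    simp only [CExp.fv, List.mem_append, List.mem_removeAll, List.mem_cons,
      List.not_mem_nil, or_false] at h
    have ht (u u' u'' : CVal) : t.Den (((ξ.update p u).update ps u').update w u'') =
        t.Den (((ξ'.update p u).update ps u').update w u'') :=
      iht fun z hz => by simp only [CEnv.update]; grind
    funext v
    simp only [CExp.Den, ihr fun z hz => h z (.inl (.inl hz)),
      ihs fun z hz => h z (.inl (.inr hz)), ht]

/-- In the unfolding of `pfold`, the recursion argument is a fresh variable `y` bound to `q`. -/
theorem CExp.den_pfold_var {r s t : CExp} {p ps w y : String}
    (hy : y ∉ (CExp.pfold r s p ps w t).fv) (ξ : CEnv) (q : ℕ) (v : CVal) :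
    (CExp.pfold (.var y) s p ps w t).Den (ξ.update y ⟨.nat, q⟩) v ↔
      FoldRel (s.Den ξ)
        (fun u u' u'' => t.Den (((ξ.update p u).update ps u').update w u'')) q v := by
  simp only [CExp.fv, List.mem_append, List.mem_removeAll, List.mem_cons,
    List.not_mem_nil, or_false] at hy
  have hs (u₀ : CVal) : s.Den (ξ.update y u₀) = s.Den ξ :=
    s.den_congr fun z hz => by simp only [CEnv.update]; grind
  have ht (u₀ u u' u'' : CVal) :
      t.Den ((((ξ.update y u₀).update p u).update ps u').update w u'') =
        t.Den (((ξ.update p u).update ps u').update w u'') :=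
    t.den_congr fun z hz => by simp only [CEnv.update]; grind
  have hfold (u₀ : CVal) : FoldRel (s.Den (ξ.update y u₀)) (fun u u' u'' =>
        t.Den ((((ξ.update y u₀).update p u).update ps u').update w u'')) q v ↔
      FoldRel (s.Den ξ)
        (fun u u' u'' => t.Den (((ξ.update p u).update ps u').update w u'')) q v := by
    simp only [hs, ht]
  constructor
  · rintro ⟨n, hn, h⟩
    obtain rfl : n = q := eq_of_heq (Sigma.mk.inj (hn.trans (ξ.update_self y _))).2
    exact (hfold _).1 h
  · exact fun h => ⟨q, (ξ.update_self y _).symm, (hfold _).2 h⟩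

theorem CSem.den {e : CExp} {ξ : CEnv} {v : CVal} (h : CSem e ξ v) : e.Den ξ v := by
  induction h with
  | var | lit => rfl
  | add _ _ ihr ihs => exact ⟨_, _, ihr, ihs, rfl⟩
  | cmax _ _ ihr ihs => exact ⟨_, _, _, ihr, ihs, rfl⟩
  | pair _ _ ihr ihs => exact ⟨_, _, _, _, ihr, ihs, rfl⟩
  | projc _ ih | projp _ ih => exact ⟨_, _, _, ih, rfl⟩
  | lam _ ih => exact ⟨_, _, _, ih, rfl⟩
  | app _ _ ihr ihs => exact ⟨_, _, _, _, _, _, ihr, ihs, rfl⟩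
  | pcaseZero _ _ ihr ihs => exact .inl ⟨ihr, ihs⟩
  | pcaseSucc _ _ _ ihr ihs iht => exact .inr ⟨_, _, _, _, ihr, ihs, iht, rfl⟩
  | pfoldZero _ _ ihr ihs => exact ⟨0, ihr, .zero ihs⟩
  | pfoldSucc hy _ _ _ _ ihr ihrec ihs iht =>
    exact ⟨_, ihr, .succ ((CExp.den_pfold_var hy _ _ _).1 ihrec) ihs iht⟩

theorem CExp.Den.csem {e : CExp} {ξ : CEnv} {v : CVal} (h : e.Den ξ v) : CSem e ξ v := by
  induction e generalizing ξ v with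
  | var x => cases h; exact .var
  | lit n => cases h; exact .lit
  | add r s ihr ihs => obtain ⟨_, _, hr, hs, rfl⟩ := h; exact .add (ihr hr) (ihs hs)
  | cmax r s ihr ihs => obtain ⟨_, _, _, hr, hs, rfl⟩ := h; exact .cmax (ihr hr) (ihs hs)
  | pair r s ihr ihs => obtain ⟨_, _, _, _, hr, hs, rfl⟩ := h; exact .pair (ihr hr) (ihs hs)
  | projc r ih => obtain ⟨_, _, _, hr, rfl⟩ := h; exact .projc (ih hr)
  | projp r ih => obtain ⟨_, _, _, hr, rfl⟩ := h; exact .projp (ih hr)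
  | lam x r ih => obtain ⟨_, _, _, hr, rfl⟩ := h; exact .lam fun p => ih (hr p)
  | app r s ihr ihs => obtain ⟨_, _, _, _, _, _, hr, hs, rfl⟩ := h; exact .app (ihr hr) (ihs hs)
  | pcase r s p ps t ihr ihs iht =>
    obtain ⟨hr, hs⟩ | ⟨_, _, _, _, hr, hs, ht, rfl⟩ := h
    · exact .pcaseZero (ihr hr) (ihs hs)
    · exact .pcaseSucc (ihr hr) (ihs hs) (iht ht)
  | pfold r s p ps w t ihr ihs iht =>
    obtain ⟨n, hr, h⟩ := h
    replace hr := ihr hr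
    clear ihr
    induction n generalizing r ξ v with
    | zero => cases h with | zero hs => exact .pfoldZero hr (ihs hs)
    | succ q ih =>
      cases h with
      | succ hrec hs ht =>
        obtain ⟨y, hy⟩ := Infinite.exists_notMem_finset (CExp.pfold r s p ps w t).fv.toFinset
        rw [List.mem_toFinset] at hy
        obtain ⟨m, hm, h⟩ := (CExp.den_pfold_var hy ξ q _).2 hrec
        refine .pfoldSucc hy hr ?_ (ihs hs) (iht ht)
        obtain rfl : m = q := eq_of_heq (Sigma.mk.inj (hm.trans (ξ.update_self y _))).2
        exact ih _ h ((congrArg (CSem _ _) hm).mpr .var)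

theorem csem_iff_den {e : CExp} {ξ : CEnv} {v : CVal} : CSem e ξ v ↔ e.Den ξ v :=
  ⟨CSem.den, CExp.Den.csem⟩

theorem CExp.den_pair_lit_var (a : ℕ) {γ : FTy} {b : γ.den} {ξ : CEnv} {y : String}
    (hy : ξ y = ⟨γ, b⟩) (v : CVal) :
    (CExp.pair (.lit a) (.var y)).Den ξ v ↔ v = ⟨.prod .nat γ, (a, b)⟩ := by
  simp only [CExp.Den, hy]
  constructor
  · rintro ⟨_, _, _, _, h₁, h₂, rfl⟩
    cases h₁
    cases h₂
    rfl
  · rintro rfl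
    exact ⟨_, _, _, _, rfl, rfl, rfl⟩

/-- Substitution for the compositional semantics, for two environments that agree away from
the substituted variable `x` and the fresh variable `y`. -/
theorem CExp.den_substPV (t : CExp) {ξ ξ' : CEnv} {x y : String} {a : ℕ} {γ : FTy} {b : γ.den}
    (hx : ξ x = ⟨.prod .nat γ, (a, b)⟩) (hy : ξ' y = ⟨γ, b⟩)
    (h : ∀ z, z ≠ x → z ≠ y → ξ z = ξ' z) (hfresh : y ∉ t.vars) :
    t.Den ξ = (t.substPV x a y).Den ξ' := by
  induction t generalizing ξ ξ' with
  | var z =>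
    funext v
    simp only [CExp.vars, List.mem_singleton] at hfresh
    by_cases hz : z = x
    · subst hz
      simp only [CExp.substPV, if_true, CExp.den_pair_lit_var a hy, CExp.Den, hx]
    · simp only [CExp.substPV, if_neg hz, CExp.Den, h z hz (Ne.symm hfresh)]
  | lit n => rfl
  | add r s ihr ihs | cmax r s ihr ihs | pair r s ihr ihs | app r s ihr ihs =>
    simp only [CExp.vars, List.mem_append, not_or] at hfresh
    funext v
    simp only [CExp.substPV, CExp.Den, ihr hx hy h hfresh.1, ihs hx hy h hfresh.2]
  | projc r ih | projp r ih =>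
    funext v
    simp only [CExp.substPV, CExp.Den, ih hx hy h hfresh]
  | lam z r ih =>
    simp only [CExp.vars, List.mem_cons, not_or] at hfresh
    have hfv := mt (@r.fv_subset_vars y) hfresh.2
    have hr (u : CVal) : r.Den (ξ.update z u) =
        (if z = x then r else r.substPV x a y).Den (ξ'.update z u) := by
      split_ifs with hz
      · exact r.den_congr fun z hz => by simp only [CEnv.update]; grind
      · apply ih _ _ _ hfresh.2 <;> simp only [CEnv.update] <;> grind
    funext v
    simp only [CExp.substPV, CExp.Den, hr]
  | pcase r s p ps t ihr ihs iht =>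
    simp only [CExp.vars, List.mem_cons, List.mem_append, not_or] at hfresh
    obtain ⟨hp, hps, ⟨hr, hs⟩, ht⟩ := hfresh
    have hfv := mt (@t.fv_subset_vars y) ht
    have ht (u u' : CVal) : t.Den ((ξ.update p u).update ps u') =
        (if p = x ∨ ps = x then t else t.substPV x a y).Den
          ((ξ'.update p u).update ps u') := by
      split_ifs with hz
      · exact t.den_congr fun z hz => by simp only [CEnv.update]; grind
      · apply iht _ _ _ ht <;> simp only [CEnv.update] <;> grind
    funext v
    simp only [CExp.substPV, CExp.Den, ihr hx hy h hr, ihs hx hy h hs, ht]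
  | pfold r s p ps w t ihr ihs iht =>
    simp only [CExp.vars, List.mem_cons, List.mem_append, not_or] at hfresh
    obtain ⟨hp, hps, hw, ⟨hr, hs⟩, ht⟩ := hfresh
    have hfv := mt (@t.fv_subset_vars y) ht
    have ht (u u' u'' : CVal) : t.Den (((ξ.update p u).update ps u').update w u'') =
        (if p = x ∨ ps = x ∨ w = x then t else t.substPV x a y).Den
          (((ξ'.update p u).update ps u').update w u'') := by
      split_ifs with hz
      · exact t.den_congr fun z hz => by simp only [CEnv.update]; grind
      · apply iht _ _ _ ht <;> simp only [CEnv.update] <;> grind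
    funext v
    simp only [CExp.substPV, CExp.Den, ihr hx hy h hr, ihs hx hy h hs, ht]

/-- **Substitution lemma** (Lemma 3): for any complexity term `t`, environment
`ξ`, variable `x`, cost `a`, potential `b` (of potential type `γ`), and fresh
variable `y`, `⟦t⟧ ξ[x ↦ (a,b)] = ⟦t[x ↦ (a,y)]⟧ ξ[y ↦ b]`, where `t[x↦(a,y)]`
substitutes the pair expression `(a, y)` for `x` in `t`.  (The denotational
semantics is given by the relation `CSem`, so the equality of the two
denotations is expressed as the equivalence of the two relations.) -/
theorem substitution_lemma (t : CExp) (ξ : CEnv) (x y : String) (a : ℕ)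
    (γ : FTy) (hγ : IsPot γ) (b : γ.den)
    (hfresh : y ∉ t.vars) (hxy : y ≠ x) :
    ∀ v : CVal,
      CSem t (ξ.update x ⟨.prod .nat γ, (a, b)⟩) v ↔
        CSem (t.substPV x a y) (ξ.update y ⟨γ, b⟩) v := by
  intro v
  rw [csem_iff_den, csem_iff_den, t.den_substPV (ξ.update_self x _) (ξ.update_self y _) _ hfresh]
  intro z hzx hzy
  exact (ξ.update_of_ne hzx _).trans (ξ.update_of_ne hzy _).symm
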